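/- Let T₀ <lex T₁ <lex … <lex T_{n−1} be pairwise distinct lists over a linearly ordered type U, listed in strictly increasing lexicographic order, and let 0 ≤ a < b ≤ n−1. Then the length of lcp(Tₐ, T_b) equals the minimum over i ∈ [a, b) of the length of lcp(Tᵢ, T_{i+1}), and for every index i ∈ [a, b) achieving this minimum one has lcp(Tₐ, T_b) = lcp(Tᵢ, T_{i+1}). -/

import Mathlib

/-- The longest common prefix of two lists: the longest list that is a prefix of both. -/
def lcp {U : Type*} [DecidableEq U] : List U → List U → List U
  | a :: as, b :: bs => if a = b then a :: lcp as bs else []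
  | _, _ => []

theorem cons_le_cons_iff_lt_or_eq {U : Type*} [LinearOrder U] {p q : U} {x y : List U} :
    p :: x ≤ q :: y ↔ p < q ∨ p = q ∧ x ≤ y := by
  rw [← not_lt, ← not_lt, List.cons_lt_cons_iff, not_or, not_lt, le_iff_lt_or_eq, not_and]
  constructor
  · rintro ⟨h | h, hx⟩
    · exact Or.inl h
    · exact Or.inr ⟨h, hx h.symm⟩
  · rintro (h | ⟨rfl, hx⟩)
    · exact ⟨Or.inl h, fun e => absurd e h.ne'⟩
    · exact ⟨Or.inr rfl, fun _ => hx⟩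

theorem lcp_prefix_lcp_of_le {U : Type*} [LinearOrder U] :
    ∀ {x y z : List U}, x ≤ y → y ≤ z →
      lcp x z <+: lcp x y ∧ lcp x z <+: lcp y z
  | [], _, _, _, _ => by simp [lcp]
  | _ :: _, [], _, hxy, _ => absurd hxy (by simp)
  | _ :: _, _ :: _, [], _, hyz => absurd hyz (by simp)
  | p :: x, q :: y, r :: z, hxy, hyz => by
    rw [cons_le_cons_iff_lt_or_eq] at hxy hyz
    by_cases hpr : p = r
    · subst hpr
      obtain hpq | ⟨rfl, hxy⟩ := hxy
      · obtain hqp | ⟨rfl, -⟩ := hyz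
        · exact absurd hpq hqp.asymm
        · exact absurd hpq (lt_irrefl _)
      · obtain hqp | ⟨-, hyz⟩ := hyz
        · exact absurd hqp (lt_irrefl _)
        · simpa [lcp] using lcp_prefix_lcp_of_le hxy hyz
    · simp [lcp, hpr]

theorem lcp_eq_or_eq_of_le {U : Type*} [LinearOrder U] :
    ∀ {x y z : List U}, x ≤ y → y ≤ z →
      lcp x z = lcp x y ∨ lcp x z = lcp y z
  | [], _, _, _, _ => by simp [lcp]
  | _ :: _, [], _, hxy, _ => absurd hxy (by simp)
  | _ :: _, _ :: _, [], _, hyz => absurd hyz (by simp)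
  | p :: x, q :: y, r :: z, hxy, hyz => by
    rw [cons_le_cons_iff_lt_or_eq] at hxy hyz
    obtain hpq | ⟨rfl, hxy⟩ := hxy
    · obtain hqr | ⟨rfl, -⟩ := hyz
      · simp [lcp, hpq.ne, (hpq.trans hqr).ne]
      · simp [lcp, hpq.ne]
    · obtain hqr | ⟨rfl, hyz⟩ := hyz
      · simp [lcp, hqr.ne]
      · simpa [lcp] using lcp_eq_or_eq_of_le hxy hyz

theorem exists_lcp_eq_lcp_succ {U : Type*} [LinearOrder U] {T : ℕ → List U} {a b : ℕ}
    (hab : a < b) (hT : MonotoneOn T (Set.Icc a b)) :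
    ∃ i ∈ Finset.Ico a b, lcp (T a) (T b) = lcp (T i) (T (i + 1)) := by
  induction b, hab using Nat.le_induction with
  | base => exact ⟨a, by simp, rfl⟩
  | succ b hab ih =>
    have hab : a < b := hab
    obtain h | h := lcp_eq_or_eq_of_le
      (hT (by simp; omega) (by simp; omega) hab.le : T a ≤ T b)
      (hT (by simp; omega) (by simp; omega) b.le_succ : T b ≤ T (b + 1))
    · obtain ⟨i, hi, hi'⟩ := ih (hT.mono (Set.Icc_subset_Icc_right b.le_succ))
      exact ⟨i, Finset.Ico_subset_Ico_right b.le_succ hi, h.trans hi'⟩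
    · exact ⟨b, by simp; omega, h⟩

theorem lcp_prefix_lcp_succ {U : Type*} [LinearOrder U] {T : ℕ → List U} {a b i : ℕ}
    (hT : MonotoneOn T (Set.Icc a b)) (hi : i ∈ Finset.Ico a b) :
    lcp (T a) (T b) <+: lcp (T i) (T (i + 1)) := by
  obtain ⟨hai, hib⟩ := Finset.mem_Ico.mp hi
  have hle {j k : ℕ} (haj : a ≤ j) (hjk : j ≤ k) (hkb : k ≤ b) : T j ≤ T k :=
    hT ⟨haj, hjk.trans hkb⟩ ⟨haj.trans hjk, hkb⟩ hjk
  exact (lcp_prefix_lcp_of_le (hle le_rfl hai hib.le) (hle hai hib.le le_rfl)).2.trans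
    (lcp_prefix_lcp_of_le (hle hai i.le_succ hib) (hle (by omega) hib le_rfl)).1

/-- Let `T₀ <lex T₁ <lex … <lex T_{n−1}` be pairwise distinct lists over a
linearly ordered type `U`, in strictly increasing lexicographic order, and let
`0 ≤ a < b ≤ n−1`. Then the length of `lcp (T a) (T b)` equals the minimum over
`i ∈ [a, b)` of the length of `lcp (T i) (T (i+1))`, and for every `i ∈ [a, b)` achieving
this minimum, `lcp (T a) (T b) = lcp (T i) (T (i+1))`. -/
theorem stmt8 {U : Type*} [LinearOrder U] (n : ℕ) (T : ℕ → List U)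
    (hmono : ∀ i j : ℕ, i < j → j < n → T i < T j)
    (a b : ℕ) (hab : a < b) (hb : b < n) :
    (lcp (T a) (T b)).length
        = (Finset.Ico a b).inf' (Finset.nonempty_Ico.mpr hab)
            (fun i => (lcp (T i) (T (i + 1))).length) ∧
    ∀ i ∈ Finset.Ico a b,
      (lcp (T i) (T (i + 1))).length
          = (Finset.Ico a b).inf' (Finset.nonempty_Ico.mpr hab)
              (fun i => (lcp (T i) (T (i + 1))).length) →
      lcp (T a) (T b) = lcp (T i) (T (i + 1)) := by
  have hT : MonotoneOn T (Set.Icc a b) := by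
    intro i _ j hj hij
    obtain rfl | hlt := hij.eq_or_lt
    · exact le_rfl
    · exact (hmono i j hlt (hj.2.trans_lt hb)).le
  have hlen : (lcp (T a) (T b)).length
      = (Finset.Ico a b).inf' (Finset.nonempty_Ico.mpr hab)
          (fun i => (lcp (T i) (T (i + 1))).length) := by
    refine le_antisymm (Finset.le_inf' _ _ fun i hi => (lcp_prefix_lcp_succ hT hi).length_le) ?_
    obtain ⟨i, hi, h⟩ := exists_lcp_eq_lcp_succ hab hT
    rw [h]
    exact Finset.inf'_le (fun i => (lcp (T i) (T (i + 1))).length) hi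
  exact ⟨hlen, fun i hi h => (lcp_prefix_lcp_succ hT hi).eq_of_length (hlen.trans h.symm)⟩
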